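/- arXiv:1209.4791 — 2 statements merged into one kernel-verified Lean document; each statement's English description precedes it below -/
import Mathlib

section
/- The group with presentation ⟨s₁, s₂ | s₁s₂s₁ = s₂s₁s₂, (s₁s₂s₁)² = 1⟩ (the quotient of B₄(S²) by the normal closure of σ₁σ₃⁻¹) is isomorphic to the free product (ZMod 2) ∗ (ZMod 3) of a cyclic group of order 2 and a cyclic group of order 3. -/
/-- The relators `s₁s₂s₁(s₂s₁s₂)⁻¹` and `(s₁s₂s₁)²` on generators `s₁ = of 0`, `s₂ = of 1`. -/
def quotRels : Set (FreeGroup (Fin 2)) :=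
  { FreeGroup.of 0 * FreeGroup.of 1 * FreeGroup.of 0 *
      (FreeGroup.of 1 * FreeGroup.of 0 * FreeGroup.of 1)⁻¹,
    (FreeGroup.of 0 * FreeGroup.of 1 * FreeGroup.of 0) ^ 2 }

/-- The homomorphism `ℤ/n → G` determined by an element whose `n`-th power is trivial. -/
def zmodPowersHom {G : Type*} [Group G] (n : ℕ) (g : G) (hg : g ^ n = 1) :
    Multiplicative (ZMod n) →* G :=
  AddMonoidHom.toMultiplicativeLeft (ZMod.lift n ⟨zmultiplesHom (Additive G) (Additive.ofMul g), by
    rw [zmultiplesHom_apply, natCast_zsmul, ← ofMul_pow, hg, ofMul_one]⟩)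

theorem zmodPowersHom_ofAdd_one {G : Type*} [Group G] (n : ℕ) (g : G) (hg : g ^ n = 1) :
    zmodPowersHom n g hg (Multiplicative.ofAdd 1) = g := by
  have h := ZMod.lift_coe n ⟨zmultiplesHom (Additive G) (Additive.ofMul g), by
    rw [zmultiplesHom_apply, natCast_zsmul, ← ofMul_pow, hg, ofMul_one]⟩ 1
  simp only [Int.cast_one, zmultiplesHom_apply, one_zsmul] at h
  exact congrArg Additive.toMul h

theorem monoidHom_ext_multiplicative_zmod {G : Type*} [Group G] {n : ℕ}
    {f g : Multiplicative (ZMod n) →* G}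
    (h : f (Multiplicative.ofAdd 1) = g (Multiplicative.ofAdd 1)) : f = g := by
  refine MonoidHom.ext fun x => ?_
  obtain ⟨k, hk⟩ := ZMod.intCast_surjective x.toAdd
  have hx : x = Multiplicative.ofAdd (1 : ZMod n) ^ k := by
    rw [← ofAdd_zsmul, zsmul_one, hk, ofAdd_toAdd]
  rw [hx, map_zpow, map_zpow, h]

theorem ofAdd_one_pow_eq_one (n : ℕ) : Multiplicative.ofAdd (1 : ZMod n) ^ n = 1 := by
  rw [← ofAdd_nsmul, nsmul_one, ZMod.natCast_self, ofAdd_zero]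

theorem lift_eq_one_of_mem_quotRels {G : Type*} [Group G] {x y : G} (hx : x ^ 2 = 1)
    (hy : y ^ 3 = 1) :
    ∀ r ∈ quotRels, FreeGroup.lift ![y⁻¹ * x, x⁻¹ * y ^ 2] r = 1 := by
  have hxx : x * x = 1 := by rw [← sq, hx]
  have hyyy : y ^ 2 * y = 1 := by rw [← pow_succ, hy]
  have hprod : y⁻¹ * x * (x⁻¹ * y ^ 2) * (y⁻¹ * x) = x := by group
  have hprod' : x⁻¹ * y ^ 2 * (y⁻¹ * x) * (x⁻¹ * y ^ 2) = x := by
    calc x⁻¹ * y ^ 2 * (y⁻¹ * x) * (x⁻¹ * y ^ 2) = x⁻¹ * y ^ 3 := by group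
      _ = x := by rw [hy, mul_one, inv_eq_of_mul_eq_one_left hxx]
  rintro r (rfl | rfl)
  · simp only [map_mul, map_inv, FreeGroup.lift_apply_of, Matrix.cons_val_zero,
      Matrix.cons_val_one]
    rw [hprod, hprod', mul_inv_cancel]
  · simp only [map_mul, map_pow, FreeGroup.lift_apply_of, Matrix.cons_val_zero,
      Matrix.cons_val_one]
    rw [hprod, hx]

theorem mul_pow_three_eq_one_of_braid {G : Type*} [Group G] {a b : G}
    (hbraid : a * b * a = b * a * b) (hsq : (a * b * a) ^ 2 = 1) : (a * b) ^ 3 = 1 :=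
  calc (a * b) ^ 3 = a * b * a * (b * a * b) := by
        simp only [pow_succ, pow_zero, one_mul, mul_assoc]
    _ = 1 := by rw [← hbraid, ← sq, hsq]

theorem braid_relation_quotRels :
    (PresentedGroup.of 0 * PresentedGroup.of 1 * PresentedGroup.of 0 : PresentedGroup quotRels) =
      PresentedGroup.of 1 * PresentedGroup.of 0 * PresentedGroup.of 1 :=
  PresentedGroup.mk_eq_mk_of_mul_inv_mem (rels := quotRels) (Or.inl rfl)

theorem garside_sq_quotRels :
    (PresentedGroup.of 0 * PresentedGroup.of 1 * PresentedGroup.of 0 :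
      PresentedGroup quotRels) ^ 2 = 1 :=
  PresentedGroup.one_of_mem (rels := quotRels) (Or.inr rfl)

theorem of_mul_of_pow_three_quotRels :
    (PresentedGroup.of 0 * PresentedGroup.of 1 : PresentedGroup quotRels) ^ 3 = 1 :=
  mul_pow_three_eq_one_of_braid braid_relation_quotRels garside_sq_quotRels

/-- The group `⟨s₁, s₂ | s₁s₂s₁ = s₂s₁s₂, (s₁s₂s₁)² = 1⟩` (the quotient of
`B₄(S²)` by the normal closure of `σ₁σ₃⁻¹`) is isomorphic to the free product
`(ℤ/2) ∗ (ℤ/3)`. -/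
theorem presentedGroup_iso_freeProduct_Z2_Z3 :
    Nonempty (PresentedGroup quotRels ≃*
      Monoid.Coprod (Multiplicative (ZMod 2)) (Multiplicative (ZMod 3))) := by
  have hx : (Monoid.Coprod.inl (Multiplicative.ofAdd 1) :
      Monoid.Coprod (Multiplicative (ZMod 2)) (Multiplicative (ZMod 3))) ^ 2 = 1 := by
    rw [← map_pow, ofAdd_one_pow_eq_one, map_one]
  have hy : (Monoid.Coprod.inr (Multiplicative.ofAdd 1) :
      Monoid.Coprod (Multiplicative (ZMod 2)) (Multiplicative (ZMod 3))) ^ 3 = 1 := by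
    rw [← map_pow, ofAdd_one_pow_eq_one, map_one]
  refine ⟨MonoidHom.toMulEquiv (PresentedGroup.toGroup (lift_eq_one_of_mem_quotRels hx hy))
    (Monoid.Coprod.lift (zmodPowersHom 2 _ garside_sq_quotRels)
      (zmodPowersHom 3 _ of_mul_of_pow_three_quotRels)) ?_ ?_⟩
  · refine PresentedGroup.ext fun i => ?_
    fin_cases i
    · simp [PresentedGroup.toGroup.of, zmodPowersHom_ofAdd_one, mul_assoc]
    · simp [PresentedGroup.toGroup.of, zmodPowersHom_ofAdd_one, sq, mul_assoc]
  · refine Monoid.Coprod.hom_ext (monoidHom_ext_multiplicative_zmod ?_)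
      (monoidHom_ext_multiplicative_zmod ?_)
    · simp [PresentedGroup.toGroup.of, zmodPowersHom_ofAdd_one, sq, mul_assoc]
    · simp [PresentedGroup.toGroup.of, zmodPowersHom_ofAdd_one, sq, mul_assoc]
end

section
/- There exist a natural number k ≥ 2 and a subgroup N of B₄(S²) such that N is normal in B₄(S²), N has finite index in B₄(S²), and N is isomorphic to the free group FreeGroup (Fin k) of rank k. In particular, B₄(S²) is virtually free. -/
/-- The defining relators of the sphere braid group `B₄(S²)` on generators
`σ₁ = of 0`, `σ₂ = of 1`, `σ₃ = of 2`:
`σ₁σ₃ = σ₃σ₁`, `σ₁σ₂σ₁ = σ₂σ₁σ₂`, `σ₂σ₃σ₂ = σ₃σ₂σ₃`, `σ₁σ₂σ₃²σ₂σ₁ = 1`. -/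
def sphereBraidRels : Set (FreeGroup (Fin 3)) :=
  { FreeGroup.of 0 * FreeGroup.of 2 * (FreeGroup.of 2 * FreeGroup.of 0)⁻¹,
    FreeGroup.of 0 * FreeGroup.of 1 * FreeGroup.of 0 *
      (FreeGroup.of 1 * FreeGroup.of 0 * FreeGroup.of 1)⁻¹,
    FreeGroup.of 1 * FreeGroup.of 2 * FreeGroup.of 1 *
      (FreeGroup.of 2 * FreeGroup.of 1 * FreeGroup.of 2)⁻¹,
    FreeGroup.of 0 * FreeGroup.of 1 * FreeGroup.of 2 ^ 2 * FreeGroup.of 1 * FreeGroup.of 0 }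

/-- The braid group `B₄(S²)` of the sphere on four strings, as a presented group. -/
abbrev B4S2 : Type := PresentedGroup sphereBraidRels

/-- The generator `σᵢ₊₁` of `B₄(S²)`. -/
def σ (i : Fin 3) : B4S2 := PresentedGroup.of i

section FreeGroupCentre

/-- An element of a free group of rank at least two commuting with all generators is trivial. -/
theorem FreeGroup.eq_one_of_forall_commute_of {α : Type*} [Nontrivial α] (w : FreeGroup α)
    (h : ∀ i, Commute w (FreeGroup.of i)) : w = 1 := by
  classical
  rw [← FreeGroup.toWord_eq_nil_iff]
  rcases hw : w.toWord with _ | ⟨⟨i, e⟩, L⟩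
  · rfl
  obtain ⟨j, hj⟩ := exists_ne i
  have hl : (FreeGroup.of j * w).toWord = (j, true) :: w.toWord := by
    have hr := FreeGroup.reduce_toWord w
    rw [FreeGroup.toWord_mul, FreeGroup.toWord_of, List.singleton_append, FreeGroup.reduce.cons,
      hr, hw]
    simp [hj]
  have hs := FreeGroup.toWord_mul_sublist w (FreeGroup.of j)
  rw [(h j).eq, hl, FreeGroup.toWord_of] at hs
  have := hs.eq_of_length (by simp)
  rw [hw] at this
  simp [hj] at this

theorem FreeGroup.conj_injective {α : Type*} [Nontrivial α] :
    Function.Injective (MulAut.conj : FreeGroup α →* MulAut (FreeGroup α)) := by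
  rw [injective_iff_map_eq_one]
  intro w hw
  refine FreeGroup.eq_one_of_forall_commute_of w fun i => ?_
  have := DFunLike.congr_fun hw (FreeGroup.of i)
  rw [MulAut.conj_apply, MulAut.one_apply, mul_inv_eq_iff_eq_mul] at this
  exact this

end FreeGroupCentre

section BraidAction

/-- The automorphism `x ↦ x`, `y ↦ y⁻¹x⁻¹` of the free group on `x, y`; its square is conjugation
by `x`. -/
def braidAutLeft : MulAut (FreeGroup (Fin 2)) :=
  MonoidHom.toMulEquiv
    (FreeGroup.lift ![FreeGroup.of 0, (FreeGroup.of 1)⁻¹ * (FreeGroup.of 0)⁻¹])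
    (FreeGroup.lift ![FreeGroup.of 0, (FreeGroup.of 0)⁻¹ * (FreeGroup.of 1)⁻¹])
    (by ext i; fin_cases i <;> simp)
    (by ext i; fin_cases i <;> simp)

/-- The automorphism `x ↦ x⁻¹y⁻¹`, `y ↦ y` of the free group on `x, y`; its square is conjugation
by `y`. -/
def braidAutRight : MulAut (FreeGroup (Fin 2)) :=
  MonoidHom.toMulEquiv
    (FreeGroup.lift ![(FreeGroup.of 0)⁻¹ * (FreeGroup.of 1)⁻¹, FreeGroup.of 1])
    (FreeGroup.lift ![(FreeGroup.of 1)⁻¹ * (FreeGroup.of 0)⁻¹, FreeGroup.of 1])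
    (by ext i; fin_cases i <;> simp)
    (by ext i; fin_cases i <;> simp)

@[simp] theorem braidAutLeft_zero : braidAutLeft (FreeGroup.of 0) = FreeGroup.of 0 := by
  simp [braidAutLeft]

@[simp] theorem braidAutLeft_one :
    braidAutLeft (FreeGroup.of 1) = (FreeGroup.of 1)⁻¹ * (FreeGroup.of 0)⁻¹ := by
  simp [braidAutLeft]

@[simp] theorem braidAutRight_zero :
    braidAutRight (FreeGroup.of 0) = (FreeGroup.of 0)⁻¹ * (FreeGroup.of 1)⁻¹ := by
  simp [braidAutRight]

@[simp] theorem braidAutRight_one : braidAutRight (FreeGroup.of 1) = FreeGroup.of 1 := by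
  simp [braidAutRight]

theorem FreeGroup.mulAut_ext {α : Type*} {f g : MulAut (FreeGroup α)}
    (h : ∀ i, f (FreeGroup.of i) = g (FreeGroup.of i)) : f = g :=
  MulEquiv.toMonoidHom_injective (FreeGroup.ext_hom _ _ h)

theorem braidAutLeft_mul_self : braidAutLeft * braidAutLeft = MulAut.conj (FreeGroup.of 0) := by
  refine FreeGroup.mulAut_ext fun i => ?_
  fin_cases i <;> simp [mul_assoc]

theorem braidAut_braid :
    braidAutLeft * braidAutRight * braidAutLeft = braidAutRight * braidAutLeft * braidAutRight := by
  refine FreeGroup.mulAut_ext fun i => ?_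
  fin_cases i <;> simp [mul_assoc]

theorem braidAut_sphere :
    braidAutLeft * braidAutRight * braidAutLeft ^ 2 * braidAutRight * braidAutLeft = 1 := by
  refine FreeGroup.mulAut_ext fun i => ?_
  fin_cases i <;> simp [mul_assoc, pow_two]

/-- The action of `B₄(S²)` on a free group of rank two. -/
def braidAction : B4S2 →* MulAut (FreeGroup (Fin 2)) :=
  PresentedGroup.toGroup (f := ![braidAutLeft, braidAutRight, braidAutLeft]) (by
    rintro r (rfl | rfl | rfl | rfl)
    · simp
    · simp [braidAut_braid, -mul_inv_rev]
    · simp [braidAut_braid, -mul_inv_rev]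
    · simpa using braidAut_sphere)

@[simp] theorem braidAction_σ (i : Fin 3) :
    braidAction (σ i) = ![braidAutLeft, braidAutRight, braidAutLeft] i :=
  PresentedGroup.toGroup.of _

end BraidAction

section Relations

theorem σ_comm : σ 0 * σ 2 = σ 2 * σ 0 :=
  mul_inv_eq_one.1 (PresentedGroup.one_of_mem (rels := sphereBraidRels) (Or.inl rfl))

theorem σ_braid₀₁ : σ 0 * σ 1 * σ 0 = σ 1 * σ 0 * σ 1 :=
  mul_inv_eq_one.1 (PresentedGroup.one_of_mem (rels := sphereBraidRels) (Or.inr (Or.inl rfl)))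

theorem σ_braid₁₂ : σ 1 * σ 2 * σ 1 = σ 2 * σ 1 * σ 2 :=
  mul_inv_eq_one.1
    (PresentedGroup.one_of_mem (rels := sphereBraidRels) (Or.inr (Or.inr (Or.inl rfl))))

theorem σ_sphere : σ 0 * σ 1 * σ 2 ^ 2 * σ 1 * σ 0 = 1 :=
  PresentedGroup.one_of_mem (rels := sphereBraidRels) (Or.inr (Or.inr (Or.inr rfl)))

theorem closure_σ : Subgroup.closure {σ 0, σ 1, σ 2} = ⊤ := by
  rw [← PresentedGroup.closure_range_of sphereBraidRels]
  congr 1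
  ext g
  simp [Fin.exists_fin_succ, σ, eq_comm]

end Relations

section ConjugationIdentities

open scoped Pointwise

variable {G : Type*} [Group G] {a b c : G}

theorem inv_mul_mul_of_braid (hab : a * b * a = b * a * b) : b⁻¹ * a * b = a * b * a⁻¹ := by
  rw [eq_mul_inv_iff_mul_eq, mul_assoc, mul_assoc, inv_mul_eq_iff_eq_mul, ← mul_assoc, hab,
    mul_assoc]

theorem garside_of_braid (hac : a * c = c * a) (hbc : b * c * b = c * b * c) :
    a * c * b * (a * c) = a * b * c * b * a :=
  calc a * c * b * (a * c) = a * (c * b * c) * a := by nth_rw 2 [hac]; simp only [mul_assoc]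
    _ = a * b * c * b * a := by rw [← hbc]; simp only [mul_assoc]

theorem commute_garside_of_braid (hac : a * c = c * a) (hab : a * b * a = b * a * b) :
    Commute b (a * b * c * b * a) :=
  calc b * (a * b * c * b * a) = b * a * b * c * b * a := by simp only [mul_assoc]
    _ = a * b * (a * c) * b * a := by rw [← hab]; simp only [mul_assoc]
    _ = a * b * c * (a * b * a) := by rw [hac]; simp only [mul_assoc]
    _ = a * b * c * b * a * b := by rw [hab]; simp only [mul_assoc]

theorem conj_eq_self_of_braid (hac : a * c = c * a) (hab : a * b * a = b * a * b)
    (hbc : b * c * b = c * b * c) :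
    b * (b * (a * c)⁻¹ * b⁻¹ * (a * c)⁻¹) * b⁻¹ = b * (a * c)⁻¹ * b⁻¹ * (a * c)⁻¹ := by
  have key : b * (a * c)⁻¹ * b⁻¹ * (a * c)⁻¹ = b * (a * b * c * b * a)⁻¹ := by
    rw [← garside_of_braid hac hbc]; group
  rw [key, mul_inv_eq_iff_eq_mul]
  exact (Commute.refl b).mul_right (commute_garside_of_braid hac hab).inv_right

theorem conj_eq_of_sphere_relations (hac : a * c = c * a) (hab : a * b * a = b * a * b)
    (hbc : b * c * b = c * b * c) (hs : a * b * c ^ 2 * b * a = 1) :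
    a * (b * (a * c)⁻¹ * b⁻¹ * (a * c)⁻¹) * a⁻¹ =
      (b * (a * c)⁻¹ * b⁻¹ * (a * c)⁻¹)⁻¹ * (a * c)⁻¹ := by
  have key : b * (a * c)⁻¹ * b⁻¹ * (a * c)⁻¹ = b * (a * b * c * b * a)⁻¹ := by
    rw [← garside_of_braid hac hbc]; group
  have hc : b⁻¹ * c⁻¹ * b⁻¹ * c = c⁻¹ * b⁻¹ := by
    calc b⁻¹ * c⁻¹ * b⁻¹ * c = b⁻¹ * (c⁻¹ * b * c)⁻¹ := by group
      _ = c⁻¹ * b⁻¹ := by rw [inv_mul_mul_of_braid hbc]; group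
  have ha : b⁻¹ * a⁻¹ * b = a * b⁻¹ * a⁻¹ := by
    calc b⁻¹ * a⁻¹ * b = (b⁻¹ * a * b)⁻¹ := by group
      _ = a * b⁻¹ * a⁻¹ := by rw [inv_mul_mul_of_braid hab]; group
  have hcc : b⁻¹ * a⁻¹ * a⁻¹ * b⁻¹ = c ^ 2 :=
    calc b⁻¹ * a⁻¹ * a⁻¹ * b⁻¹
        = b⁻¹ * a⁻¹ * (a * b * c ^ 2 * b * a) * a⁻¹ * b⁻¹ := by rw [hs]; group
      _ = c ^ 2 := by group
  have hac' : c * a⁻¹ = a⁻¹ * c := by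
    rw [mul_inv_eq_iff_eq_mul, mul_assoc, ← hac, inv_mul_cancel_left]
  rw [key, ← mul_inv_eq_one]
  calc a * (b * (a * b * c * b * a)⁻¹) * a⁻¹ * ((b * (a * b * c * b * a)⁻¹)⁻¹ * (a * c)⁻¹)⁻¹
      = a * b * a⁻¹ * (b⁻¹ * c⁻¹ * b⁻¹) * (a⁻¹ * c) * b * a⁻¹ * b⁻¹ * c⁻¹ * b⁻¹ * a⁻¹ := by group
    _ = a * b * a⁻¹ * (b⁻¹ * c⁻¹ * b⁻¹ * c) * a⁻¹ * b * a⁻¹ * b⁻¹ * c⁻¹ * b⁻¹ * a⁻¹ := by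
      rw [← hac']; group
    _ = a * b * a⁻¹ * c⁻¹ * (b⁻¹ * a⁻¹ * b) * a⁻¹ * b⁻¹ * c⁻¹ * b⁻¹ * a⁻¹ := by rw [hc]; group
    _ = a * b * (c * a)⁻¹ * a * (b⁻¹ * a⁻¹ * a⁻¹ * b⁻¹) * c⁻¹ * b⁻¹ * a⁻¹ := by rw [ha]; group
    _ = 1 := by rw [hcc, ← hac]; group

/-- The braid relation together with `aba⁻²ba = 1`, the sphere relation for `σ₃ = σ₁⁻¹`, defines a
finite group. -/
theorem finite_of_sphere_relations (hgen : Subgroup.closure {a, b} = ⊤)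
    (hab : a * b * a = b * a * b) (hs : a * b * a⁻¹ ^ 2 * b * a = 1) : Finite G := by
  have hconj : a * b * a⁻¹ = a⁻¹ * b⁻¹ * a :=
    calc a * b * a⁻¹ = a * b * a⁻¹ ^ 2 * b * a * a⁻¹ * b⁻¹ * a := by group
      _ = a⁻¹ * b⁻¹ * a := by rw [hs]; group
  have haab : a ^ 2 * b = b⁻¹ * a ^ 2 :=
    calc a ^ 2 * b = a * (a * b * a⁻¹) * a := by simp [pow_two, mul_assoc]
      _ = b⁻¹ * a ^ 2 := by rw [hconj]; simp [pow_two, mul_assoc]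
  have hbba : b ^ 2 * a = a⁻¹ * b ^ 2 := by
    have h : b⁻¹ * a * b = (b * a * b⁻¹)⁻¹ := by
      rw [inv_mul_mul_of_braid hab, hconj]
      calc a⁻¹ * b⁻¹ * a = (a⁻¹ * b * a)⁻¹ := by group
        _ = (b * a * b⁻¹)⁻¹ := by rw [inv_mul_mul_of_braid hab.symm]
    calc b ^ 2 * a = b * (b * a * b⁻¹) * b := by simp [pow_two, mul_assoc]
      _ = b * (b⁻¹ * a * b)⁻¹ * b := by rw [h, inv_inv]
      _ = a⁻¹ * b ^ 2 := by simp [pow_two, mul_assoc]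
  have hbaa : b * a ^ 2 = a ^ 2 * b⁻¹ := by
    rw [eq_mul_inv_iff_mul_eq, mul_assoc, haab, mul_inv_cancel_left]
  have h4 : a ^ 4 = b ^ 4 := by
    have h : a ^ 2 * b⁻¹ * b⁻¹ = a⁻¹ * a⁻¹ * b ^ 2 :=
      calc a ^ 2 * b⁻¹ * b⁻¹ = b * (b * a ^ 2) := by rw [hbaa, ← mul_assoc, hbaa]
        _ = (b ^ 2 * a) * a := by simp [pow_two, mul_assoc]
        _ = a⁻¹ * (b ^ 2 * a) := by rw [hbba, mul_assoc, hbba]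
        _ = a⁻¹ * a⁻¹ * b ^ 2 := by rw [hbba, mul_assoc]
    calc a ^ 4 = a ^ 2 * (a ^ 2 * b⁻¹ * b⁻¹) * b ^ 2 := by group
      _ = b ^ 4 := by rw [h]; group
  have h8 : a ^ 8 = 1 := by
    have h : a ^ 2 * b ^ 4 * a⁻¹ ^ 2 = (b ^ 4)⁻¹ :=
      calc a ^ 2 * b ^ 4 * a⁻¹ ^ 2 = (a ^ 2 * b * a⁻¹ ^ 2) ^ 4 := by rw [inv_pow, conj_pow]
        _ = (b ^ 4)⁻¹ := by rw [haab]; group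
    rw [← h4] at h
    calc a ^ 8 = (a ^ 2 * a ^ 4 * a⁻¹ ^ 2) * a ^ 4 := by group
      _ = 1 := by rw [h]; group
  have hb8 : b ^ 8 = 1 := by
    rw [show 8 = 4 * 2 from rfl, pow_mul, ← h4, ← pow_mul, h8]
  let R : Set G := {1, b, b ^ 2, b ^ 3, b * a, b ^ 3 * a}
  let S : Set G := (Subgroup.zpowers a : Set G) * R
  have hmem (n : ℤ) {r : G} (hr : r ∈ R) : a ^ n * r ∈ S :=
    Set.mul_mem_mul (Subgroup.zpow_mem_zpowers a n) hr
  have hb_inv : b⁻¹ = a ^ (-4 : ℤ) * b ^ 3 := by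
    rw [zpow_neg, zpow_ofNat, h4]; group
  have hSa : ∀ g ∈ S, g * a ∈ S := by
    rintro _ ⟨_, ⟨n, rfl⟩, r, rfl | hr | rfl | rfl | rfl | rfl, rfl⟩
    · convert hmem (n + 1) (r := 1) (by simp [R]) using 1
      group
    · rw [hr]
      convert hmem n (r := b * a) (by simp [R]) using 1
      group
    · convert hmem (n - 1) (r := b ^ 2) (by simp [R]) using 1
      rw [mul_assoc, hbba]; group
    · convert hmem n (r := b ^ 3 * a) (by simp [R]) using 1
      group
    · convert hmem (n - 2) (r := b ^ 3) (by simp [R]) using 1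
      rw [mul_assoc, mul_assoc, ← pow_two, hbaa, hb_inv]; group
    · convert hmem (n - 2) (r := b) (by simp [R]) using 1
      calc a ^ n * (b ^ 3 * a) * a
          = a ^ n * (b ^ 2 * a) * (a⁻¹ * (b * a ^ 2)) := by simp [pow_succ, mul_assoc]
        _ = a ^ n * a⁻¹ * b ^ 2 * a * b⁻¹ := by rw [hbba, hbaa]; group
        _ = a ^ n * a⁻¹ * (b ^ 2 * a) * b⁻¹ := by group
        _ = a ^ (n - 2) * b := by rw [hbba]; group
  have hSb : ∀ g ∈ S, g * b ∈ S := by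
    rintro _ ⟨_, ⟨n, rfl⟩, r, rfl | hr | rfl | rfl | rfl | rfl, rfl⟩
    · convert hmem n (r := b) (by simp [R]) using 1
      group
    · rw [hr]
      convert hmem n (r := b ^ 2) (by simp [R]) using 1
      simp [pow_two, mul_assoc]
    · convert hmem n (r := b ^ 3) (by simp [R]) using 1
      group
    · convert hmem (n + 4) (r := 1) (by simp [R]) using 1
      rw [mul_assoc, ← pow_succ, ← h4]; group
    · convert hmem (n + 1) (r := b * a) (by simp [R]) using 1
      rw [mul_assoc, ← hab]; group
    · convert hmem (n - 1) (r := b ^ 3 * a) (by simp [R]) using 1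
      calc a ^ n * (b ^ 3 * a) * b = a ^ n * b ^ 2 * (b * a * b) := by group
        _ = a ^ n * (b ^ 2 * a) * b * a := by rw [← hab]; group
        _ = a ^ (n - 1) * (b ^ 3 * a) := by rw [hbba]; group
  have hpow {x : G} (hx : ∀ g ∈ S, g * x ∈ S) (n : ℕ) : ∀ g ∈ S, g * x ^ n ∈ S := by
    induction n with
    | zero => simp
    | succ n ih => exact fun g hg => by simpa [pow_succ, mul_assoc] using hx _ (ih g hg)
  have hS : ∀ g : G, g ∈ S := fun g => by
    have hg : g ∈ Subgroup.closure {a, b} := hgen ▸ Subgroup.mem_top g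
    induction hg using Subgroup.closure_induction_right with
    | one => simpa using hmem 0 (r := 1) (by simp [R])
    | mul_right x _ y hy hx =>
      rcases hy with rfl | rfl
      exacts [hSa _ hx, hSb _ hx]
    | mul_inv_cancel x _ y hy hx =>
      rcases hy with rfl | rfl
      · rw [show y⁻¹ = y ^ 7 from inv_eq_of_mul_eq_one_right (by rw [← pow_succ', h8])]
        exact hpow hSa 7 _ hx
      · rw [show y⁻¹ = y ^ 7 from inv_eq_of_mul_eq_one_right (by rw [← pow_succ', hb8])]
        exact hpow hSb 7 _ hx
  have hfin : (Subgroup.zpowers a : Set G).Finite :=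
    (isOfFinOrder_iff_pow_eq_one.2 ⟨8, by norm_num, h8⟩).finite_zpowers
  exact Set.finite_univ_iff.1 ((hfin.mul (Set.toFinite R)).subset fun g _ => hS g)

end ConjugationIdentities

section FreeSubgroup

/-- The homomorphism from the free group of rank two to `B₄(S²)` sending the generators to `σ₁σ₃`
and to `σ₂(σ₁σ₃)⁻¹σ₂⁻¹(σ₁σ₃)⁻¹`. -/
def freeToB4S2 : FreeGroup (Fin 2) →* B4S2 :=
  FreeGroup.lift ![σ 0 * σ 2, σ 1 * (σ 0 * σ 2)⁻¹ * (σ 1)⁻¹ * (σ 0 * σ 2)⁻¹]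

@[simp] theorem freeToB4S2_zero : freeToB4S2 (FreeGroup.of 0) = σ 0 * σ 2 := by
  simp [freeToB4S2]

theorem freeToB4S2_one : freeToB4S2 (FreeGroup.of 1) =
    σ 1 * (σ 0 * σ 2)⁻¹ * (σ 1)⁻¹ * (σ 0 * σ 2)⁻¹ := by
  simp [freeToB4S2]

theorem braidAction_comp_freeToB4S2 : braidAction.comp freeToB4S2 = MulAut.conj := by
  refine FreeGroup.ext_hom _ _ fun i => ?_
  fin_cases i
  · simp [braidAutLeft_mul_self]
  · have h : braidAutRight * MulAut.conj (FreeGroup.of 0)⁻¹ * braidAutRight⁻¹ =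
        MulAut.conj (braidAutRight (FreeGroup.of 0)⁻¹) := by
      ext w; simp [mul_assoc]
    have h' : braidAction (freeToB4S2 (FreeGroup.of 1)) =
        braidAutRight * (braidAutLeft * braidAutLeft)⁻¹ * braidAutRight⁻¹ *
          (braidAutLeft * braidAutLeft)⁻¹ := by
      simp [freeToB4S2_one]
    change braidAction (freeToB4S2 (FreeGroup.of 1)) = MulAut.conj (FreeGroup.of 1)
    rw [h', braidAutLeft_mul_self, ← map_inv, h, ← map_mul]
    simp

theorem freeToB4S2_injective : Function.Injective freeToB4S2 := by
  have h := FreeGroup.conj_injective (α := Fin 2)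
  rw [← braidAction_comp_freeToB4S2, MonoidHom.coe_comp] at h
  exact h.of_comp

/-- If conjugation by `g` is intertwined by `f` with an automorphism of the source, then `g`
normalizes the range of `f`. -/
theorem mem_normalizer_range_of_intertwine {F G : Type*} [Group F] [Group G] (f : F →* G) (g : G)
    (φ : MulAut F) (h : ∀ w, f (φ w) = g * f w * g⁻¹) :
    g ∈ Subgroup.normalizer (f.range : Set G) := by
  rw [Subgroup.mem_normalizer_iff]
  refine fun x => ⟨?_, ?_⟩
  · rintro ⟨w, rfl⟩
    exact ⟨φ w, h w⟩
  · rintro ⟨w, hw⟩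
    refine ⟨φ.symm w, ?_⟩
    have := h (φ.symm w)
    rw [MulEquiv.apply_symm_apply, hw] at this
    simpa using this.symm

theorem freeToB4S2_intertwine (i : Fin 3) (w : FreeGroup (Fin 2)) :
    freeToB4S2 (braidAction (σ i) w) = σ i * freeToB4S2 w * (σ i)⁻¹ := by
  suffices h : freeToB4S2.comp (braidAction (σ i)).toMonoidHom =
      (MulAut.conj (σ i)).toMonoidHom.comp freeToB4S2 from DFunLike.congr_fun h w
  have h01 := conj_eq_of_sphere_relations σ_comm σ_braid₀₁ σ_braid₁₂ σ_sphere
  have h11 := conj_eq_self_of_braid σ_comm σ_braid₀₁ σ_braid₁₂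
  have hs : σ 2 * σ 1 * σ 0 ^ 2 * σ 1 * σ 2 = 1 := by
    have h : σ 2 ^ 2 = (σ 1 * σ 0 ^ 2 * σ 1)⁻¹ :=
      calc σ 2 ^ 2 = (σ 0 * σ 1)⁻¹ * (σ 0 * σ 1 * σ 2 ^ 2 * σ 1 * σ 0) * (σ 1 * σ 0)⁻¹ := by group
        _ = (σ 1 * σ 0 ^ 2 * σ 1)⁻¹ := by rw [σ_sphere]; simp [pow_two, mul_assoc]
    calc σ 2 * σ 1 * σ 0 ^ 2 * σ 1 * σ 2 = σ 2 * (σ 1 * σ 0 ^ 2 * σ 1) * σ 2 := by group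
      _ = 1 := by rw [← inv_eq_iff_eq_inv.2 h]; group
  have h21 := conj_eq_of_sphere_relations σ_comm.symm σ_braid₁₂.symm σ_braid₀₁.symm hs
  rw [← σ_comm] at h21
  refine FreeGroup.ext_hom _ _ fun j => ?_
  fin_cases i <;> fin_cases j
  · simp [σ_comm, mul_assoc]
  · simpa [freeToB4S2_one] using h01.symm
  · simp [freeToB4S2_one, mul_assoc]
  · simpa [freeToB4S2_one] using h11.symm
  · simp [← σ_comm, mul_assoc]
  · simpa [freeToB4S2_one] using h21.symm

theorem freeToB4S2_range_normal : freeToB4S2.range.Normal := by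
  rw [← Subgroup.normalizer_eq_top_iff, eq_top_iff, ← closure_σ, Subgroup.closure_le]
  have h (i : Fin 3) : σ i ∈ Subgroup.normalizer (freeToB4S2.range : Set B4S2) :=
    mem_normalizer_range_of_intertwine _ _ (braidAction (σ i)) (freeToB4S2_intertwine i)
  rintro _ (rfl | rfl | rfl) <;> exact h _

theorem freeToB4S2_range_finiteIndex : freeToB4S2.range.FiniteIndex := by
  have := freeToB4S2_range_normal
  let q := QuotientGroup.mk' freeToB4S2.range
  have hc : q (σ 2) = (q (σ 0))⁻¹ := by
    rw [eq_inv_iff_mul_eq_one, ← map_mul, ← σ_comm, ← freeToB4S2_zero]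
    exact (QuotientGroup.eq_one_iff _).2 ⟨_, rfl⟩
  have hgen : Subgroup.closure {q (σ 0), q (σ 1)} = ⊤ := by
    rw [eq_top_iff, ← Subgroup.map_top_of_surjective q (QuotientGroup.mk'_surjective _),
      ← closure_σ, MonoidHom.map_closure, Subgroup.closure_le]
    have h0 : q (σ 0) ∈ Subgroup.closure {q (σ 0), q (σ 1)} :=
      Subgroup.subset_closure (Or.inl rfl)
    rintro _ ⟨_, rfl | rfl | rfl, rfl⟩
    · exact h0
    · exact Subgroup.subset_closure (Or.inr rfl)
    · rw [hc]
      exact inv_mem h0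
  have : Finite (B4S2 ⧸ freeToB4S2.range) := by
    refine finite_of_sphere_relations hgen ?_ ?_
    · simpa using congrArg q σ_braid₀₁
    · simpa [hc] using congrArg q σ_sphere
  exact Subgroup.finiteIndex_of_finite_quotient

end FreeSubgroup

/-- `B₄(S²)` contains a normal subgroup of finite index that is free of
rank `k` for some `k ≥ 2`; in particular `B₄(S²)` is virtually free. -/
theorem b4S2_virtually_free :
    ∃ k : ℕ, 2 ≤ k ∧ ∃ N : Subgroup B4S2, N.Normal ∧ N.FiniteIndex ∧
      Nonempty (N ≃* FreeGroup (Fin k)) := by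
  exact ⟨2, le_rfl, freeToB4S2.range, freeToB4S2_range_normal, freeToB4S2_range_finiteIndex,
    ⟨(MonoidHom.ofInjective freeToB4S2_injective).symm⟩⟩
end
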